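/- If a connected weighted graph G contains a cut node, then either G is a path graph or G has some node with strictly negative node resistance curvature. -/

import Mathlib

open Matrix

variable {V : Type*}

/- The weighted Laplacian matrix of a weighted graph `(V, G, c)`:
`Q i i = ∑_{k ∼ i} c i k`, `Q i j = -c i j` for links `i ∼ j`, and `0` otherwise. -/
open Classical in
noncomputable def lapMatrix [Fintype V] (G : SimpleGraph V) (c : V → V → ℝ) :
    Matrix V V ℝ :=
  Matrix.of fun i j =>
    if i = j then ∑ k, if G.Adj i k then c i k else 0
    else if G.Adj i j then -c i j else 0

/- The four Penrose equations characterizing the Moore–Penrose pseudoinverse. -/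
def IsMoorePenroseInv [Fintype V] (Q Qd : Matrix V V ℝ) : Prop :=
  Q * Qd * Q = Q ∧ Qd * Q * Qd = Qd ∧ (Q * Qd)ᵀ = Q * Qd ∧ (Qd * Q)ᵀ = Qd * Q

/- The effective resistance `ω i j = (e_i - e_j)ᵀ Q† (e_i - e_j)`, computed from a
pseudoinverse `Qd` of the Laplacian. -/
open Classical in
noncomputable def effRes [Fintype V] (Qd : Matrix V V ℝ) (i j : V) : ℝ :=
  (Pi.single i 1 - Pi.single j 1) ⬝ᵥ Qd *ᵥ (Pi.single i 1 - Pi.single j 1)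

/- The node resistance curvature `p i = 1 - (1/2) ∑_{j ∼ i} c i j * ω i j`. -/
open Classical in
noncomputable def nodeCurv [Fintype V] (G : SimpleGraph V) (c : V → V → ℝ)
    (Qd : Matrix V V ℝ) (i : V) : ℝ :=
  1 - 1 / 2 * ∑ j, if G.Adj i j then c i j * effRes Qd i j else 0

/- A node `i` is a cut node if removing it (and its incident links) from its
connected component disconnects that component, i.e. leaves more than one
connected component. -/
def IsCutNode (G : SimpleGraph V) (i : V) : Prop :=
  1 < Nat.card (SimpleGraph.induce {v | G.Reachable i v ∧ v ≠ i} G).ConnectedComponent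

/- A path graph: a tree in which exactly two nodes have degree 1 and all
other nodes have degree 2. -/
def IsPathGraph [Fintype V] (G : SimpleGraph V) [DecidableRel G.Adj] : Prop :=
  G.IsTree ∧ {v : V | G.degree v = 1}.ncard = 2 ∧
    ∀ v : V, G.degree v ≠ 1 → G.degree v = 2

/-- The weight of the link `i ∼ j`, extended by zero to nonadjacent pairs. -/
noncomputable def linkWeight (G : SimpleGraph V) (c : V → V → ℝ) (i j : V) : ℝ :=
  open Classical in if G.Adj i j then c i j else 0

section LinkWeight

variable {G : SimpleGraph V} {c : V → V → ℝ}

lemma linkWeight_of_adj {i j : V} (h : G.Adj i j) : linkWeight G c i j = c i j := if_pos h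

lemma linkWeight_of_not_adj {i j : V} (h : ¬ G.Adj i j) : linkWeight G c i j = 0 := if_neg h

lemma linkWeight_self (i : V) : linkWeight G c i i = 0 := linkWeight_of_not_adj G.irrefl

lemma linkWeight_comm (hsymm : ∀ i j, c i j = c j i) (i j : V) :
    linkWeight G c i j = linkWeight G c j i := by
  by_cases h : G.Adj i j
  · rw [linkWeight_of_adj h, linkWeight_of_adj h.symm, hsymm i j]
  · rw [linkWeight_of_not_adj h, linkWeight_of_not_adj fun h' => h h'.symm]

lemma linkWeight_pos (hpos : ∀ i j, G.Adj i j → 0 < c i j) {i j : V} (h : G.Adj i j) :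
    0 < linkWeight G c i j := by
  rw [linkWeight_of_adj h]
  exact hpos i j h

lemma linkWeight_nonneg (hpos : ∀ i j, G.Adj i j → 0 < c i j) (i j : V) :
    0 ≤ linkWeight G c i j := by
  by_cases h : G.Adj i j
  · exact (linkWeight_pos hpos h).le
  · rw [linkWeight_of_not_adj h]

end LinkWeight

section Laplacian

variable [Fintype V] {G : SimpleGraph V} {c : V → V → ℝ}

lemma lapMatrix_mulVec_apply (x : V → ℝ) (i : V) :
    (lapMatrix G c *ᵥ x) i = ∑ j, linkWeight G c i j * (x i - x j) := by
  classical
  have h : ∀ j, lapMatrix G c i j =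
      (if i = j then ∑ k, linkWeight G c i k else 0) - linkWeight G c i j := by
    intro j
    by_cases hij : i = j
    · subst hij
      simp [lapMatrix, linkWeight]
    · by_cases hadj : G.Adj i j <;> simp [lapMatrix, linkWeight, hij, hadj]
  simp only [mulVec, dotProduct, h, sub_mul, ite_mul, zero_mul, mul_sub,
    Finset.sum_sub_distrib, Finset.sum_ite_eq, Finset.mem_univ, if_true, Finset.sum_mul]

lemma lapMatrix_transpose (hsymm : ∀ i j, c i j = c j i) :
    (lapMatrix G c)ᵀ = lapMatrix G c := by
  ext i j
  by_cases hij : i = j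
  · simp [hij]
  · by_cases hadj : G.Adj i j
    · simp [lapMatrix, hij, Ne.symm hij, hadj, hadj.symm, hsymm j i]
    · simp [lapMatrix, hij, Ne.symm hij, hadj, G.adj_comm j i]

lemma dotProduct_lapMatrix_mulVec_comm (hsymm : ∀ i j, c i j = c j i) (x y : V → ℝ) :
    x ⬝ᵥ lapMatrix G c *ᵥ y = y ⬝ᵥ lapMatrix G c *ᵥ x := by
  rw [dotProduct_mulVec, ← mulVec_transpose, lapMatrix_transpose hsymm, dotProduct_comm]

lemma two_mul_dotProduct_lapMatrix_mulVec (hsymm : ∀ i j, c i j = c j i) (x : V → ℝ) :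
    2 * (x ⬝ᵥ lapMatrix G c *ᵥ x) = ∑ i, ∑ j, linkWeight G c i j * (x i - x j) ^ 2 := by
  have h : x ⬝ᵥ lapMatrix G c *ᵥ x = ∑ i, ∑ j, x i * (linkWeight G c i j * (x i - x j)) := by
    simp only [dotProduct, lapMatrix_mulVec_apply, Finset.mul_sum]
  have h' : x ⬝ᵥ lapMatrix G c *ᵥ x = ∑ i, ∑ j, x j * (linkWeight G c i j * (x j - x i)) := by
    rw [h, Finset.sum_comm]
    simp only [linkWeight_comm hsymm]
  rw [two_mul]
  nth_rewrite 1 [h]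
  rw [h', ← Finset.sum_add_distrib]
  refine Finset.sum_congr rfl fun i _ => ?_
  rw [← Finset.sum_add_distrib]
  exact Finset.sum_congr rfl fun j _ => by ring

lemma dotProduct_lapMatrix_mulVec_nonneg (hsymm : ∀ i j, c i j = c j i)
    (hpos : ∀ i j, G.Adj i j → 0 < c i j) (x : V → ℝ) : 0 ≤ x ⬝ᵥ lapMatrix G c *ᵥ x := by
  have h : 0 ≤ ∑ i, ∑ j, linkWeight G c i j * (x i - x j) ^ 2 :=
    Finset.sum_nonneg fun i _ => Finset.sum_nonneg fun j _ =>
      mul_nonneg (linkWeight_nonneg hpos i j) (sq_nonneg _)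
  linarith [two_mul_dotProduct_lapMatrix_mulVec (G := G) hsymm x]

lemma eq_of_adj_of_dotProduct_lapMatrix_mulVec_eq_zero (hsymm : ∀ i j, c i j = c j i)
    (hpos : ∀ i j, G.Adj i j → 0 < c i j) {x : V → ℝ} (hx : x ⬝ᵥ lapMatrix G c *ᵥ x = 0)
    {i j : V} (hij : G.Adj i j) : x i = x j := by
  have h := two_mul_dotProduct_lapMatrix_mulVec (G := G) hsymm x
  have hnonneg : ∀ i j, 0 ≤ linkWeight G c i j * (x i - x j) ^ 2 := fun i j =>
    mul_nonneg (linkWeight_nonneg hpos i j) (sq_nonneg _)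
  rw [hx, mul_zero, eq_comm, Finset.sum_eq_zero_iff_of_nonneg
    fun i _ => Finset.sum_nonneg fun j _ => hnonneg i j] at h
  have h' := (Finset.sum_eq_zero_iff_of_nonneg fun j _ => hnonneg i j).1
    (h i (Finset.mem_univ i)) j (Finset.mem_univ j)
  rcases mul_eq_zero.1 h' with h0 | h0
  · exact absurd h0 (linkWeight_pos hpos hij).ne'
  · exact sub_eq_zero.1 (pow_eq_zero_iff two_ne_zero |>.1 h0)

lemma lapMatrix_mulVec_eq_zero_of_dotProduct_eq_zero (hsymm : ∀ i j, c i j = c j i)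
    (hpos : ∀ i j, G.Adj i j → 0 < c i j) {x : V → ℝ} (hx : x ⬝ᵥ lapMatrix G c *ᵥ x = 0) :
    lapMatrix G c *ᵥ x = 0 := by
  ext i
  rw [lapMatrix_mulVec_apply]
  refine Finset.sum_eq_zero fun j _ => ?_
  by_cases hij : G.Adj i j
  · rw [eq_of_adj_of_dotProduct_lapMatrix_mulVec_eq_zero hsymm hpos hx hij, sub_self, mul_zero]
  · rw [linkWeight_of_not_adj hij, zero_mul]

/-- The range of the Laplacian of a connected graph contains every vector of zero sum, and
`Q Q†` is the identity there. -/
lemma lapMatrix_mulVec_pinv_mulVec (hsymm : ∀ i j, c i j = c j i)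
    (hpos : ∀ i j, G.Adj i j → 0 < c i j) (hconn : G.Connected) {Qd : Matrix V V ℝ}
    (hQd : IsMoorePenroseInv (lapMatrix G c) Qd) {u : V → ℝ} (hu : ∑ k, u k = 0) :
    lapMatrix G c *ᵥ (Qd *ᵥ u) = u := by
  obtain ⟨h1, -, h3, -⟩ := hQd
  set Q := lapMatrix G c with hQ
  have hQT : Qᵀ = Q := lapMatrix_transpose hsymm
  have hQP : Q * (Q * Qd) = Q := by
    have h := congrArg transpose h1
    rwa [transpose_mul, h3, hQT] at h
  set g : V → ℝ := u - Q *ᵥ (Qd *ᵥ u) with hg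
  have hQg : Q *ᵥ g = 0 := by
    rw [hg, mulVec_sub, mulVec_mulVec, mulVec_mulVec, Matrix.mul_assoc, hQP, sub_self]
  have hconst : ∀ i j, g i = g j := by
    intro i j
    have hreach := (SimpleGraph.reachable_iff_reflTransGen i j).1 (hconn.preconnected i j)
    induction hreach with
    | refl => rfl
    | tail _ hadj ih =>
      exact ih.trans (eq_of_adj_of_dotProduct_lapMatrix_mulVec_eq_zero hsymm hpos
        (by rw [← hQ, hQg, dotProduct_zero]) hadj)
  have hsum : ∑ k, g k = 0 := by
    have hQ1 : Q *ᵥ (fun _ => (1 : ℝ)) = 0 := by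
      ext i
      simp [hQ, lapMatrix_mulVec_apply]
    have h := dotProduct_lapMatrix_mulVec_comm (G := G) hsymm (fun _ => (1 : ℝ)) (Qd *ᵥ u)
    rw [← hQ, hQ1, dotProduct_zero] at h
    simp only [dotProduct, one_mul] at h
    simp only [hg, Pi.sub_apply, Finset.sum_sub_distrib, hu, h, sub_zero]
  have hzero : g = 0 := by
    ext i
    have : Nonempty V := ⟨i⟩
    rw [Finset.sum_congr rfl fun k _ => hconst k i] at hsum
    simpa using hsum
  exact (sub_eq_zero.1 hzero).symm

end Laplacian

/-- Removing the node `i` disconnects the nonempty set `A` from a nonempty rest. -/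
structure Separates (G : SimpleGraph V) (i : V) (A : Set V) : Prop where
  nonempty : A.Nonempty
  exists_notMem : ∃ b, b ∉ A ∧ b ≠ i
  notMem : i ∉ A
  closed : ∀ a ∈ A, ∀ b, G.Adj a b → b ∈ A ∨ b = i

lemma SimpleGraph.Reachable.mem_of_closed {G : SimpleGraph V} {S : Set V}
    (hS : ∀ a ∈ S, ∀ b, G.Adj a b → b ∈ S) {v w : V} (h : G.Reachable v w) (hv : v ∈ S) :
    w ∈ S := by
  rw [SimpleGraph.reachable_iff_reflTransGen] at h
  induction h with
  | refl => exact hv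
  | tail _ hadj ih => exact hS _ ih _ hadj

namespace Separates

variable {G : SimpleGraph V} {i : V} {A : Set V}

/-- The other side of a separation. -/
lemma compl (h : Separates G i A) : Separates G i {b | b ∉ A ∧ b ≠ i} where
  nonempty := h.exists_notMem
  exists_notMem := by
    obtain ⟨a, ha⟩ := h.nonempty
    exact ⟨a, fun h' => h'.1 ha, fun hai => h.notMem (hai ▸ ha)⟩
  notMem h' := h'.2 rfl
  closed := by
    rintro a ⟨ha, hai⟩ b hab
    by_cases hbi : b = i
    · exact Or.inr hbi
    · refine Or.inl ⟨fun hb => ?_, hbi⟩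
      rcases h.closed b hb a hab.symm with h' | h'
      exacts [ha h', hai h']

lemma exists_adj (h : Separates G i A) (hconn : G.Connected) : ∃ a ∈ A, G.Adj i a := by
  by_contra! hno
  obtain ⟨a, ha⟩ := h.nonempty
  refine h.notMem ((hconn.preconnected a i).mem_of_closed (fun x hx y hxy => ?_) ha)
  rcases h.closed x hx y hxy with hy | rfl
  exacts [hy, absurd hxy.symm (hno x hx)]

lemma isBridge (h : Separates G i A) {a : V} (ha : a ∈ A)
    (huniq : ∀ b ∈ A, G.Adj i b → b = a) (hadj : G.Adj i a) : G.IsBridge s(i, a) := by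
  rw [SimpleGraph.isBridge_iff]
  intro hreach
  refine h.notMem (hreach.symm.mem_of_closed (fun x hx y hxy => ?_) ha)
  rw [SimpleGraph.deleteEdges_adj] at hxy
  rcases h.closed x hx y hxy.1 with hy | rfl
  · exact hy
  · exact absurd (by simp [huniq x hx hxy.1.symm, Sym2.eq_swap]) hxy.2

variable [Fintype V] {c : V → V → ℝ} {Qd : Matrix V V ℝ}

/-- The effective resistance of a link is at least the inverse of the total weight between `i` and
its side of the separation, strictly so if that side contains another neighbour of `i`. -/
lemma le_mul_effRes (h : Separates G i A) (hsymm : ∀ i j, c i j = c j i)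
    (hpos : ∀ i j, G.Adj i j → 0 < c i j) (hconn : G.Connected)
    (hQd : IsMoorePenroseInv (lapMatrix G c) Qd) {C : ℝ}
    (hC : C = open Classical in ∑ k, if k ∈ A then linkWeight G c i k else 0)
    {j : V} (hj : j ∈ A) :
    C ≤ C ^ 2 * effRes Qd i j ∧
      ((∃ k ∈ A, k ≠ j ∧ G.Adj i k) → C < C ^ 2 * effRes Qd i j) := by
  classical
  have hij : i ≠ j := fun hij => h.notMem (hij ▸ hj)
  set u : V → ℝ := Pi.single i 1 - Pi.single j 1 with hu
  set x : V → ℝ := Qd *ᵥ u with hx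
  set f : V → ℝ := fun k => if k ∈ A then 1 else 0 with hf
  have hQx : lapMatrix G c *ᵥ x = u :=
    lapMatrix_mulVec_pinv_mulVec hsymm hpos hconn hQd (by simp [hu])
  have homega : x ⬝ᵥ lapMatrix G c *ᵥ x = effRes Qd i j := by
    rw [hQx, dotProduct_comm]
    rfl
  have hfx : f ⬝ᵥ lapMatrix G c *ᵥ x = -1 := by
    rw [hQx, hu, dotProduct_sub, dotProduct_single, dotProduct_single]
    simp [hf, h.notMem, hj]
  have hQf : ∀ k ∈ A, (lapMatrix G c *ᵥ f) k = linkWeight G c i k := by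
    intro k hk
    rw [lapMatrix_mulVec_apply, Finset.sum_eq_single i]
    · simp [hf, hk, h.notMem, linkWeight_comm hsymm k i]
    · intro l _ hl
      by_cases hkl : G.Adj k l
      · simp [hf, hk, (h.closed k hk l hkl).resolve_right hl]
      · rw [linkWeight_of_not_adj hkl, zero_mul]
    · simp
  have hff : f ⬝ᵥ lapMatrix G c *ᵥ f = C := by
    rw [hC, dotProduct]
    refine Finset.sum_congr rfl fun k _ => ?_
    by_cases hk : k ∈ A
    · rw [hQf k hk, if_pos hk]
      simp [hf, hk]
    · simp [hf, hk]
  have hquad : (f + C • x) ⬝ᵥ lapMatrix G c *ᵥ (f + C • x) = C ^ 2 * effRes Qd i j - C := by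
    rw [mulVec_add, mulVec_smul, dotProduct_add, add_dotProduct, add_dotProduct,
      smul_dotProduct, smul_dotProduct, dotProduct_smul, dotProduct_smul,
      dotProduct_lapMatrix_mulVec_comm hsymm x f, hfx, hff, homega]
    simp only [smul_eq_mul]
    ring
  have hle : C ≤ C ^ 2 * effRes Qd i j := by
    linarith [dotProduct_lapMatrix_mulVec_nonneg (G := G) hsymm hpos (f + C • x)]
  refine ⟨hle, fun ⟨k, hk, hkj, hik⟩ => lt_of_le_of_ne hle fun heq => ?_⟩
  have hzero := congrFun (lapMatrix_mulVec_eq_zero_of_dotProduct_eq_zero hsymm hpos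
    (hquad.trans (sub_eq_zero.2 heq.symm))) k
  have hki : k ≠ i := fun hki => h.notMem (hki ▸ hk)
  rw [mulVec_add, mulVec_smul, hQx, Pi.add_apply, hQf k hk] at hzero
  simp only [hu, Pi.smul_apply, Pi.sub_apply, Pi.single_eq_of_ne hki, Pi.single_eq_of_ne hkj,
    sub_self, smul_zero, add_zero, Pi.zero_apply] at hzero
  exact (linkWeight_pos hpos hik).ne' hzero

/-- The relative resistances of the links between `i` and one side of a separation add up to at
least one, strictly so if there are several of them. -/
lemma one_le_sum_effRes (h : Separates G i A) (hsymm : ∀ i j, c i j = c j i)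
    (hpos : ∀ i j, G.Adj i j → 0 < c i j) (hconn : G.Connected)
    (hQd : IsMoorePenroseInv (lapMatrix G c) Qd) :
    (1 ≤ open Classical in
      ∑ j, if j ∈ A then linkWeight G c i j * effRes Qd i j else 0) ∧
    ((∃ j ∈ A, ∃ k ∈ A, k ≠ j ∧ G.Adj i j ∧ G.Adj i k) → 1 < open Classical in
      ∑ j, if j ∈ A then linkWeight G c i j * effRes Qd i j else 0) := by
  classical
  obtain ⟨C, hC⟩ : ∃ C, C = ∑ k, if k ∈ A then linkWeight G c i k else 0 := ⟨_, rfl⟩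
  have hCpos : 0 < C := by
    obtain ⟨a, ha, hia⟩ := h.exists_adj hconn
    rw [hC]
    refine Finset.sum_pos' (fun k _ => ?_) ⟨a, Finset.mem_univ a, ?_⟩
    · split_ifs
      exacts [linkWeight_nonneg hpos i k, le_rfl]
    · rw [if_pos ha]
      exact linkWeight_pos hpos hia
  have hCsq : 0 < C ^ 2 := pow_pos hCpos 2
  have hone : ∑ k, (if k ∈ A then linkWeight G c i k * (C / C ^ 2) else 0) = 1 := by
    have : ∑ k, (if k ∈ A then linkWeight G c i k * (C / C ^ 2) else 0) = C * (C / C ^ 2) := by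
      conv_rhs => rw [hC, Finset.sum_mul, ← hC]
      exact Finset.sum_congr rfl fun k _ => by split_ifs <;> simp
    rw [this]
    field_simp
  have hterm : ∀ k, (if k ∈ A then linkWeight G c i k * (C / C ^ 2) else 0) ≤
      if k ∈ A then linkWeight G c i k * effRes Qd i k else 0 := by
    intro k
    split_ifs with hk
    · refine mul_le_mul_of_nonneg_left ?_ (linkWeight_nonneg hpos i k)
      rw [div_le_iff₀' hCsq]
      exact (h.le_mul_effRes hsymm hpos hconn hQd (by convert hC) hk).1
    · exact le_rfl
  constructor
  · rw [← hone]
    exact Finset.sum_le_sum fun k _ => hterm k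
  · rintro ⟨j, hj, k, hk, hkj, hij, hik⟩
    rw [← hone]
    refine Finset.sum_lt_sum (fun k _ => hterm k) ⟨j, Finset.mem_univ j, ?_⟩
    rw [if_pos hj, if_pos hj]
    refine mul_lt_mul_of_pos_left ?_ (linkWeight_pos hpos hij)
    rw [div_lt_iff₀' hCsq]
    exact (h.le_mul_effRes hsymm hpos hconn hQd (by convert hC) hj).2 ⟨k, hk, hkj, hik⟩

/-- A separating node of nonnegative curvature has a single neighbour on each side. -/
lemma eq_of_adj_of_nodeCurv_nonneg (h : Separates G i A) (hsymm : ∀ i j, c i j = c j i)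
    (hpos : ∀ i j, G.Adj i j → 0 < c i j) (hconn : G.Connected)
    (hQd : IsMoorePenroseInv (lapMatrix G c) Qd) (hcurv : 0 ≤ nodeCurv G c Qd i)
    {j k : V} (hj : j ∈ A) (hk : k ∈ A) (hij : G.Adj i j) (hik : G.Adj i k) : k = j := by
  classical
  by_contra hkj
  have hA := (h.one_le_sum_effRes hsymm hpos hconn hQd).2 ⟨j, hj, k, hk, hkj, hij, hik⟩
  have hB : 1 ≤ ∑ j,
      if j ∈ {b | b ∉ A ∧ b ≠ i} then linkWeight G c i j * effRes Qd i j else 0 := by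
    convert (h.compl.one_le_sum_effRes hsymm hpos hconn hQd).1
  have hsum : nodeCurv G c Qd i = 1 - 1 / 2 *
      ((∑ j, if j ∈ A then linkWeight G c i j * effRes Qd i j else 0) +
        ∑ j, if j ∈ {b | b ∉ A ∧ b ≠ i} then linkWeight G c i j * effRes Qd i j else 0) := by
    rw [nodeCurv, ← Finset.sum_add_distrib]
    congr 2
    refine Finset.sum_congr rfl fun l _ => ?_
    by_cases hl : l ∈ A
    · simp [hl, linkWeight]
    · by_cases hli : l = i
      · simp [hli, linkWeight_self]
      · simp [hl, hli, linkWeight]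
  linarith

/-- All links at a separating node of nonnegative curvature are bridges, and there are at most
two of them. -/
lemma isBridge_and_subset_pair (h : Separates G i A) (hsymm : ∀ i j, c i j = c j i)
    (hpos : ∀ i j, G.Adj i j → 0 < c i j) (hconn : G.Connected)
    (hQd : IsMoorePenroseInv (lapMatrix G c) Qd) (hcurv : 0 ≤ nodeCurv G c Qd i) :
    (∀ j, G.Adj i j → G.IsBridge s(i, j)) ∧ ∃ a b, ∀ j, G.Adj i j → j = a ∨ j = b := by
  obtain ⟨a, ha, hia⟩ := h.exists_adj hconn
  obtain ⟨b, hb, hib⟩ := h.compl.exists_adj hconn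
  have hua : ∀ j ∈ A, G.Adj i j → j = a := fun j hj hij =>
    h.eq_of_adj_of_nodeCurv_nonneg hsymm hpos hconn hQd hcurv ha hj hia hij
  have hub : ∀ j ∈ {b | b ∉ A ∧ b ≠ i}, G.Adj i j → j = b := fun j hj hij =>
    h.compl.eq_of_adj_of_nodeCurv_nonneg hsymm hpos hconn hQd hcurv hb hj hib hij
  have hall : ∀ j, G.Adj i j → j = a ∨ j = b := by
    intro j hij
    by_cases hj : j ∈ A
    · exact Or.inl (hua j hj hij)
    · exact Or.inr (hub j ⟨hj, hij.ne'⟩ hij)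
  refine ⟨fun j hij => ?_, a, b, hall⟩
  rcases hall j hij with rfl | rfl
  exacts [h.isBridge ha hua hij, h.compl.isBridge hb hub hij]

end Separates

/-- A cut node separates some set of nodes. -/
lemma IsCutNode.exists_separates [Finite V] {G : SimpleGraph V} (hconn : G.Connected) {i : V}
    (h : IsCutNode G i) : ∃ A, Separates G i A := by
  obtain ⟨K, L, hKL⟩ := (Finite.one_lt_card_iff_nontrivial.1 h).exists_pair_ne
  induction K using SimpleGraph.ConnectedComponent.ind with | _ a
  induction L using SimpleGraph.ConnectedComponent.ind with | _ b
  refine ⟨{v | ∃ hv, (G.induce {v | G.Reachable i v ∧ v ≠ i}).Reachable a ⟨v, hv⟩},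
    ⟨a, a.2, .rfl⟩, ⟨b, fun ⟨_, hb⟩ => hKL (SimpleGraph.ConnectedComponent.sound hb), b.2.2⟩,
    fun ⟨hi, _⟩ => hi.2 rfl, ?_⟩
  rintro x ⟨hx, hax⟩ y hxy
  by_cases hyi : y = i
  · exact Or.inr hyi
  · have hy : y ∈ {v | G.Reachable i v ∧ v ≠ i} := ⟨hconn.preconnected i y, hyi⟩
    have hadj : (G.induce {v | G.Reachable i v ∧ v ≠ i}).Adj ⟨x, hx⟩ ⟨y, hy⟩ := hxy
    exact Or.inl ⟨hy, hax.trans hadj.reachable⟩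

/-- An endpoint of a bridge that has another neighbour is separating. -/
lemma SimpleGraph.IsBridge.exists_separates {G : SimpleGraph V} {v w x : V}
    (h : G.IsBridge s(v, w)) (hwx : G.Adj w x) (hxv : x ≠ v) : ∃ A, Separates G w A := by
  rw [SimpleGraph.isBridge_iff] at h
  refine ⟨{a | (G.deleteEdges {s(v, w)}).Reachable v a}, ⟨v, .rfl⟩,
    ⟨x, fun hx => h (hx.trans (Adj.reachable ?_)), hwx.ne'⟩, h, fun a ha b hab => ?_⟩
  · rw [SimpleGraph.deleteEdges_adj]
    refine ⟨hwx.symm, ?_⟩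
    simp [hxv, hwx.ne']
  · by_cases hbw : b = w
    · exact Or.inr hbw
    · refine Or.inl (SimpleGraph.Reachable.trans ha (Adj.reachable ?_))
      rw [SimpleGraph.deleteEdges_adj]
      refine ⟨hab, ?_⟩
      have haw : a ≠ w := fun haw => h (haw ▸ ha)
      simp [hbw, haw]

/-- A tree with at least two nodes and maximum degree at most two is a path graph. -/
lemma isPathGraph_of_isTree_of_degree_le_two [Fintype V] [Nontrivial V] {G : SimpleGraph V}
    [DecidableRel G.Adj] (hG : G.IsTree) (hdeg : ∀ v, G.degree v ≤ 2) : IsPathGraph G := by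
  classical
  have hcases : ∀ v, G.degree v = 1 ∨ G.degree v = 2 := fun v => by
    have := hG.connected.preconnected.degree_pos_of_nontrivial v
    have := hdeg v
    omega
  refine ⟨hG, ?_, fun v hv => (hcases v).resolve_left hv⟩
  have hsum : ∑ v, (G.degree v + if G.degree v = 1 then 1 else 0) = ∑ _v : V, 2 :=
    Finset.sum_congr rfl fun v _ => by rcases hcases v with h | h <;> simp [h]
  rw [Finset.sum_add_distrib, G.sum_degrees_eq_twice_card_edges, ← Finset.card_filter,
    Finset.sum_const, Finset.card_univ, smul_eq_mul, ← hG.card_edgeFinset] at hsum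
  have hset : {v : V | G.degree v = 1} =
      (Finset.univ.filter fun v => G.degree v = 1 : Finset V) := by
    ext
    simp
  rw [hset, Set.ncard_coe_finset]
  omega

/- STATEMENT 9: if a connected weighted graph has a cut node, then it is a path
graph or it has a node of strictly negative node resistance curvature. -/
theorem cutNode_implies_path_or_negative_curvature
    [Fintype V] [DecidableEq V] (G : SimpleGraph V) [DecidableRel G.Adj]
    (c : V → V → ℝ) (hsymm : ∀ i j, c i j = c j i)
    (hpos : ∀ i j, G.Adj i j → 0 < c i j)
    (hconn : G.Connected)
    (Qd : Matrix V V ℝ) (hQd : IsMoorePenroseInv (lapMatrix G c) Qd)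
    (hcut : ∃ i, IsCutNode G i) :
    IsPathGraph G ∨ ∃ v, nodeCurv G c Qd v < 0 := by
  refine or_iff_not_imp_right.2 fun hcurv => ?_
  push Not at hcurv
  obtain ⟨i, hi⟩ := hcut
  obtain ⟨A, hA⟩ := hi.exists_separates hconn
  have hsep : ∀ v A, Separates G v A →
      (∀ w, G.Adj v w → G.IsBridge s(v, w)) ∧ ∃ a b, ∀ w, G.Adj v w → w = a ∨ w = b :=
    fun v _ h => h.isBridge_and_subset_pair hsymm hpos hconn hQd (hcurv v)
  have hall : ∀ v, v ∈ {v | (∀ w, G.Adj v w → G.IsBridge s(v, w)) ∧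
      ∃ a b, ∀ w, G.Adj v w → w = a ∨ w = b} := by
    intro v
    refine (hconn.preconnected i v).mem_of_closed (fun x hx y hxy => ?_) (hsep i A hA)
    have hbridge := hx.1 y hxy
    by_cases hleaf : ∀ z, G.Adj y z → z = x
    · refine ⟨fun z hyz => ?_, x, x, fun z hyz => Or.inl (hleaf z hyz)⟩
      rw [hleaf z hyz, Sym2.eq_swap]
      exact hbridge
    · push Not at hleaf
      obtain ⟨z, hyz, hzx⟩ := hleaf
      obtain ⟨B, hB⟩ := hbridge.exists_separates hyz hzx
      exact hsep y B hB
  have htree : G.IsTree :=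
    ⟨hconn, SimpleGraph.isAcyclic_iff_forall_adj_isBridge.2 fun {v w} hvw => (hall v).1 w hvw⟩
  have : Nontrivial V := by
    obtain ⟨a, ha⟩ := hA.nonempty
    exact ⟨a, i, fun hai => hA.notMem (hai ▸ ha)⟩
  refine isPathGraph_of_isTree_of_degree_le_two htree fun v => ?_
  obtain ⟨a, b, hab⟩ := (hall v).2
  rw [← G.card_neighborFinset_eq_degree]
  refine (Finset.card_le_card (t := {a, b}) fun w hw => ?_).trans Finset.card_le_two
  simpa using hab w ((G.mem_neighborFinset v w).1 hw)
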